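/- arXiv:1312.6282 — 5 statements merged into one kernel-verified Lean document; each statement's English description precedes it below -/
import Mathlib

section
/- Let p be a stochastic language with S_p^{(2)} < ∞, let U, V be finite subsets of Σ*, let ξ be a random string distributed according to p, and let Z = Z(ξ) be the U×V random matrix Z[u,v] = 1_{ξ=uv} − p(uv). Then ‖E(Z·Zᵀ)‖₂ ≤ S_p^{(2)} and ‖E(Zᵀ·Z)‖₂ ≤ S_p^{(2)} (indeed both ‖E(Z·Zᵀ)‖_∞ and ‖E(Z·Zᵀ)‖₁ are bounded by S_p^{(2)}, and similarly for Zᵀ·Z). -/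
open MeasureTheory Matrix

/-- The spectral norm (largest singular value) of a real matrix. -/
noncomputable def specNorm {m n : Type*} [Fintype m] [Fintype n] [DecidableEq n]
    (M : Matrix m n ℝ) : ℝ :=
  ‖(Matrix.toEuclideanLin M).toContinuousLinearMap‖

/-- The maximum absolute row sum norm `‖M‖_∞`. -/
noncomputable def rowSumNorm {m n : Type*} [Fintype n] (M : Matrix m n ℝ) : ℝ :=
  ⨆ i, ∑ j, |M i j|

/-- The maximum absolute column sum norm `‖M‖₁`. -/
noncomputable def colSumNorm {m n : Type*} [Fintype m] (M : Matrix m n ℝ) : ℝ :=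
  ⨆ j, ∑ i, |M i j|

theorem rowSumNorm_le {m n : Type*} [Fintype n] {M : Matrix m n ℝ} {S : ℝ} (hS : 0 ≤ S)
    (h : ∀ i, ∑ j, |M i j| ≤ S) : rowSumNorm M ≤ S :=
  Real.iSup_le h hS

theorem colSumNorm_le {m n : Type*} [Fintype m] {M : Matrix m n ℝ} {S : ℝ} (hS : 0 ≤ S)
    (h : ∀ j, ∑ i, |M i j| ≤ S) : colSumNorm M ≤ S :=
  Real.iSup_le h hS

/-- The Schur test: a common bound for the absolute row and column sums bounds the spectral norm. -/
theorem specNorm_le_of_sum_abs_le {m n : Type*} [Fintype m] [Fintype n] [DecidableEq n]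
    {M : Matrix m n ℝ} {S : ℝ} (hS : 0 ≤ S) (hrow : ∀ i, ∑ j, |M i j| ≤ S)
    (hcol : ∀ j, ∑ i, |M i j| ≤ S) : specNorm M ≤ S := by
  refine ContinuousLinearMap.opNorm_le_bound _ hS fun x => ?_
  refine le_of_sq_le_sq ?_ (by positivity)
  rw [mul_pow, EuclideanSpace.real_norm_sq_eq, EuclideanSpace.real_norm_sq_eq]
  have key (i : m) : (∑ j, M i j * x j) ^ 2 ≤ S * ∑ j, |M i j| * x j ^ 2 := by
    calc (∑ j, M i j * x j) ^ 2
        ≤ (∑ j, |M i j|) * ∑ j, |M i j| * x j ^ 2 := by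
          refine Finset.sum_sq_le_sum_mul_sum_of_sq_le_mul _ (fun j _ => abs_nonneg _)
            (fun j _ => by positivity) fun j _ => ?_
          rw [mul_pow, ← sq_abs (M i j), sq |M i j|, mul_assoc]
      _ ≤ S * ∑ j, |M i j| * x j ^ 2 :=
          mul_le_mul_of_nonneg_right (hrow i) (Finset.sum_nonneg fun j _ => by positivity)
  calc ∑ i, ((Matrix.toEuclideanLin M).toContinuousLinearMap x) i ^ 2
      = ∑ i, (∑ j, M i j * x j) ^ 2 := rfl
    _ ≤ ∑ i, S * ∑ j, |M i j| * x j ^ 2 := Finset.sum_le_sum fun i _ => key i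
    _ = S * ∑ j, (∑ i, |M i j|) * x j ^ 2 := by
        rw [← Finset.mul_sum, Finset.sum_comm]
        simp_rw [Finset.sum_mul]
    _ ≤ S * ∑ j, S * x j ^ 2 := by
        gcongr with j
        exact hcol j
    _ = S ^ 2 * ∑ j, x j ^ 2 := by rw [← Finset.mul_sum]; ring

/-- A word `w` has at most `|w| + 1` factorizations as a concatenation of two words. -/
theorem card_filter_append_eq_le {α : Type*} [DecidableEq α] (U V : Finset (List α))
    (w : List α) : ((U ×ˢ V).filter fun x => x.1 ++ x.2 = w).card ≤ w.length + 1 := by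
  rw [← Finset.card_range (w.length + 1)]
  refine Finset.card_le_card_of_injOn (fun x => x.1.length) ?_ ?_
  · rintro ⟨u, v⟩ h
    obtain ⟨-, rfl⟩ := Finset.mem_filter.1 (Finset.mem_coe.1 h)
    simp
  · rintro ⟨u, v⟩ h ⟨u', v'⟩ h' hl
    have h1 := (Finset.mem_filter.1 (Finset.mem_coe.1 h)).2
    have h2 := (Finset.mem_filter.1 (Finset.mem_coe.1 h')).2
    obtain ⟨rfl, rfl⟩ := List.append_inj (h1.trans h2.symm) hl
    rfl

theorem sum_append_le_tsum {α : Type*} [DecidableEq α] {p : List α → ℝ} (hp0 : ∀ w, 0 ≤ p w)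
    (hS2 : Summable fun w : List α => ((w.length : ℝ) + 1) * p w) (U V : Finset (List α)) :
    ∑ u ∈ U, ∑ v ∈ V, p (u ++ v) ≤ ∑' w : List α, ((w.length : ℝ) + 1) * p w := by
  rw [← Finset.sum_product' U V fun u v => p (u ++ v),
    ← Finset.sum_fiberwise_of_maps_to (g := fun x : List α × List α => x.1 ++ x.2)
      (t := (U ×ˢ V).image fun x => x.1 ++ x.2) fun x hx => Finset.mem_image_of_mem _ hx]
  refine le_trans (Finset.sum_le_sum fun w _ => ?_)
    (hS2.sum_le_tsum _ fun w _ => mul_nonneg (by positivity) (hp0 w))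
  rw [Finset.sum_congr rfl fun x hx => congrArg p (Finset.mem_filter.1 hx).2,
    Finset.sum_const, nsmul_eq_mul]
  exact mul_le_mul_of_nonneg_right (mod_cast card_filter_append_eq_le U V w) (hp0 w)

section Covariance

variable {β Ω : Type*} [DecidableEq β] [MeasurableSpace Ω] {μ : Measure Ω}
  [IsProbabilityMeasure μ] {p : β → ℝ} {ξ : Ω → β}

theorem integrable_centered_mul (hmeas : ∀ w, MeasurableSet {ω | ξ ω = w}) (a b : β) :
    Integrable (fun ω => ((if ξ ω = a then 1 else 0) - p a) *
      ((if ξ ω = b then 1 else 0) - p b)) μ := by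
  have hm (c : β) : Measurable fun ω => (if ξ ω = c then (1 : ℝ) else 0) - p c :=
    (Measurable.ite (hmeas c) measurable_const measurable_const).sub_const _
  have hb (c : β) (ω : Ω) : |(if ξ ω = c then (1 : ℝ) else 0) - p c| ≤ 1 + |p c| := by
    refine (abs_sub _ _).trans (add_le_add_left ?_ _)
    split_ifs <;> simp
  refine Integrable.of_bound ((hm a).mul (hm b)).aestronglyMeasurable
    ((1 + |p a|) * (1 + |p b|)) (.of_forall fun ω => ?_)
  rw [Real.norm_eq_abs, abs_mul]
  exact mul_le_mul (hb a ω) (hb b ω) (abs_nonneg _) (by positivity)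

theorem integral_centered_mul (hp0 : ∀ w, 0 ≤ p w) (hmeas : ∀ w, MeasurableSet {ω | ξ ω = w})
    (hdist : ∀ w, μ {ω | ξ ω = w} = ENNReal.ofReal (p w)) (a b : β) :
    ∫ ω, ((if ξ ω = a then 1 else 0) - p a) * ((if ξ ω = b then 1 else 0) - p b) ∂μ =
      (if a = b then p a else 0) - p a * p b := by
  have hind (c : β) : (fun ω => if ξ ω = c then (1 : ℝ) else 0) =
      {ω | ξ ω = c}.indicator 1 := by
    ext ω
    simp [Set.indicator_apply]
  have hind_int (c : β) : Integrable (fun ω => if ξ ω = c then (1 : ℝ) else 0) μ := by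
    rw [hind]
    exact (integrable_const (1 : ℝ)).indicator (hmeas c)
  have hval (c : β) : ∫ ω, (if ξ ω = c then (1 : ℝ) else 0) ∂μ = p c := by
    rw [hind, integral_indicator_one (hmeas c), Measure.real, hdist,
      ENNReal.toReal_ofReal (hp0 c)]
  have hexp (ω : Ω) : ((if ξ ω = a then 1 else 0) - p a) * ((if ξ ω = b then 1 else 0) - p b) =
      ((if a = b then 1 else 0) - p b) * (if ξ ω = a then 1 else 0) -
        p a * (if ξ ω = b then 1 else 0) + p a * p b := by
    by_cases hab : a = b
    · subst hab
      (split_ifs <;> simp_all); ring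
    · by_cases ha : ξ ω = a
      · have hb : ξ ω ≠ b := ha ▸ hab
        simp only [if_pos ha, if_neg hb, if_neg hab]
        ring
      · simp only [if_neg ha, if_neg hab]
        ring
  simp_rw [hexp]
  rw [integral_add (by exact ((hind_int a).const_mul _).sub ((hind_int b).const_mul _))
      (integrable_const _),
    integral_sub ((hind_int a).const_mul _) ((hind_int b).const_mul _), integral_const_mul,
    integral_const_mul, hval, hval, integral_const, probReal_univ, one_smul]
  split_ifs <;> ring

/-- The expected Gram matrix of a centered indicator matrix is bounded entrywise by the total
mass of either of the two rows involved. -/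
theorem abs_integral_sum_centered_mul_le {I J : Type*} [Fintype J] (hp0 : ∀ w, 0 ≤ p w)
    (hp1 : ∀ w, p w ≤ 1) (hmeas : ∀ w, MeasurableSet {ω | ξ ω = w})
    (hdist : ∀ w, μ {ω | ξ ω = w} = ENNReal.ofReal (p w)) (f : I → J → β) (i i' : I) :
    |∫ ω, ∑ j, ((if ξ ω = f i j then 1 else 0) - p (f i j)) *
      ((if ξ ω = f i' j then 1 else 0) - p (f i' j)) ∂μ| ≤ ∑ j, p (f i j) ∧
    |∫ ω, ∑ j, ((if ξ ω = f i j then 1 else 0) - p (f i j)) *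
      ((if ξ ω = f i' j then 1 else 0) - p (f i' j)) ∂μ| ≤ ∑ j, p (f i' j) := by
  rw [integral_finsetSum _ fun j _ => integrable_centered_mul hmeas _ _]
  simp_rw [integral_centered_mul hp0 hmeas hdist]
  have key (a b : β) : |(if a = b then p a else 0) - p a * p b| ≤ p a ∧
      |(if a = b then p a else 0) - p a * p b| ≤ p b := by
    have ha := hp0 a
    have hb := hp0 b
    have ha1 := hp1 a
    have hb1 := hp1 b
    simp only [abs_le]
    split_ifs with h
    · subst h
      refine ⟨⟨?_, ?_⟩, ?_, ?_⟩ <;> nlinarith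
    · refine ⟨⟨?_, ?_⟩, ?_, ?_⟩ <;> nlinarith
  exact ⟨(Finset.abs_sum_le_sum_abs _ _).trans (Finset.sum_le_sum fun j _ => (key _ _).1),
    (Finset.abs_sum_le_sum_abs _ _).trans (Finset.sum_le_sum fun j _ => (key _ _).2)⟩

end Covariance

theorem norms_le_of_abs_le {n : Type*} [Fintype n] [DecidableEq n] {M : Matrix n n ℝ}
    {b : n → ℝ} {S : ℝ} (hS : 0 ≤ S) (hb : ∑ i, b i ≤ S)
    (h : ∀ i j, |M i j| ≤ b i ∧ |M i j| ≤ b j) :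
    specNorm M ≤ S ∧ rowSumNorm M ≤ S ∧ colSumNorm M ≤ S := by
  have hrow (i : n) : ∑ j, |M i j| ≤ S := (Finset.sum_le_sum fun j _ => (h i j).2).trans hb
  have hcol (j : n) : ∑ i, |M i j| ≤ S := (Finset.sum_le_sum fun i _ => (h i j).1).trans hb
  exact ⟨specNorm_le_of_sum_abs_le hS hrow hcol, rowSumNorm_le hS hrow, colSumNorm_le hS hcol⟩

/-- for a stochastic language `p` with `S_p⁽²⁾ = ∑_w (|w|+1)·p(w) < ∞`,
finite `U, V ⊆ Σ*`, a random string `ξ ∼ p` and the `U × V` random matrix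
`Z[u,v] = 1_{ξ=uv} − p(uv)`, the matrices `E(Z·Zᵀ)` and `E(Zᵀ·Z)` (expectations taken
entrywise) have spectral, max-row-sum and max-column-sum norms bounded by `S_p⁽²⁾`. -/
theorem hankel_expected_square_norm_bound {α Ω : Type*} [Fintype α] [DecidableEq α]
    [MeasurableSpace Ω] (μ : Measure Ω) [IsProbabilityMeasure μ]
    (p : List α → ℝ) (hp0 : ∀ w, 0 ≤ p w) (hp1 : HasSum p 1)
    (hS2 : Summable fun w : List α => ((w.length : ℝ) + 1) * p w)
    (U V : Finset (List α))
    (ξ : Ω → List α)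
    (hmeas : ∀ w : List α, MeasurableSet {ω | ξ ω = w})
    (hdist : ∀ w : List α, μ {ω | ξ ω = w} = ENNReal.ofReal (p w))
    (Z : Ω → Matrix ↥U ↥V ℝ)
    (hZ : ∀ ω (u : ↥U) (v : ↥V),
      Z ω u v = (if ξ ω = ↑u ++ ↑v then 1 else 0) - p (↑u ++ ↑v))
    (A : Matrix ↥U ↥U ℝ) (hA : ∀ u u', A u u' = ∫ ω, (Z ω * (Z ω)ᵀ) u u' ∂μ)
    (B : Matrix ↥V ↥V ℝ) (hB : ∀ v v', B v v' = ∫ ω, ((Z ω)ᵀ * Z ω) v v' ∂μ) :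
    specNorm A ≤ ∑' w : List α, ((w.length : ℝ) + 1) * p w ∧
    specNorm B ≤ ∑' w : List α, ((w.length : ℝ) + 1) * p w ∧
    rowSumNorm A ≤ ∑' w : List α, ((w.length : ℝ) + 1) * p w ∧
    colSumNorm A ≤ ∑' w : List α, ((w.length : ℝ) + 1) * p w ∧
    rowSumNorm B ≤ ∑' w : List α, ((w.length : ℝ) + 1) * p w ∧
    colSumNorm B ≤ ∑' w : List α, ((w.length : ℝ) + 1) * p w := by
  have hle1 (w : List α) : p w ≤ 1 := le_hasSum hp1 w fun _ _ => hp0 _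
  have hS : 0 ≤ ∑' w : List α, ((w.length : ℝ) + 1) * p w :=
    tsum_nonneg fun w => mul_nonneg (by positivity) (hp0 w)
  have hsum : ∑ u : U, ∑ v : V, p (↑u ++ ↑v) ≤ ∑' w : List α, ((w.length : ℝ) + 1) * p w := by
    refine le_of_eq_of_le ?_ (sum_append_le_tsum hp0 hS2 U V)
    rw [← Finset.sum_coe_sort U]
    exact Finset.sum_congr rfl fun u _ => Finset.sum_coe_sort V fun v => p (↑u ++ v)
  obtain ⟨hA2, hAr, hAc⟩ := norms_le_of_abs_le (M := A) hS hsum fun u u' => by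
    simp only [hA, Matrix.mul_apply, Matrix.transpose_apply, hZ]
    exact abs_integral_sum_centered_mul_le hp0 hle1 hmeas hdist
      (fun (u : U) (v : V) => (u : List α) ++ v) u u'
  obtain ⟨hB2, hBr, hBc⟩ := norms_le_of_abs_le (M := B) hS (Finset.sum_comm.trans_le hsum)
    fun v v' => by
      simp only [hB, Matrix.mul_apply, Matrix.transpose_apply, hZ]
      exact abs_integral_sum_centered_mul_le hp0 hle1 hmeas hdist
        (fun (v : V) (u : U) => (u : List α) ++ v) v v'
  exact ⟨hA2, hB2, hAr, hAc, hBr, hBc⟩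
end

section
/- Let p be a stochastic language admitting a d-dimensional linear representation ⟨I, M, T⟩, let η ∈ [0,1], and suppose the matrix series ∑_{n≥0} ηⁿ·M_Σⁿ converges with sum (I_d − η·M_Σ)^{-1}. Set T̄_η = (I_d − η·M_Σ)^{-1}·T. Then for every u ∈ Σ*, p̄_η(u) = Iᵀ·M(u)·T̄_η; in particular p̄_η is rational with linear representation ⟨I, M, T̄_η⟩. -/
open Matrix

/-- The sum of a word-indexed multiplicative family over all words of length `n` is the `n`-th
power of its sum over letters. -/
theorem sum_ofFn_eq_pow {α R : Type*} [Fintype α] [Semiring R] (M : List α → R)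
    (hM1 : M [] = 1) (hMmul : ∀ u v : List α, M (u ++ v) = M u * M v) (n : ℕ) :
    ∑ v : Fin n → α, M (List.ofFn v) = (∑ x : α, M [x]) ^ n := by
  induction n with
  | zero => simp [hM1]
  | succ n ih =>
    rw [← (Fin.consEquiv fun _ : Fin (n + 1) => α).sum_comp, Fintype.sum_prod_type, pow_succ',
      ← ih, Finset.sum_mul_sum]
    refine Finset.sum_congr rfl fun a _ => Finset.sum_congr rfl fun v _ => ?_
    rw [← hMmul]
    simp [Fin.consEquiv, List.ofFn_succ]

/-- if `p` is a stochastic language with `d`-dimensional linear representation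
`⟨I, M, T⟩`, `η ∈ [0,1]`, and the matrix series `∑ₙ ηⁿ·M_Σⁿ` converges with sum
`(I_d − η·M_Σ)⁻¹`, then with `T̄_η = (I_d − η·M_Σ)⁻¹·T` one has, for every `u ∈ Σ*`,
`p̄_η(u) = Iᵀ·M(u)·T̄_η`, i.e. `⟨I, M, T̄_η⟩` is a linear representation of `p̄_η`. -/
theorem smoothed_prefix_rational {α : Type*} [Fintype α] [DecidableEq α]
    (p : List α → ℝ) (hp0 : ∀ w, 0 ≤ p w) (hp1 : HasSum p 1)
    {d : ℕ} (I T : Fin d → ℝ) (M : List α → Matrix (Fin d) (Fin d) ℝ)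
    (hM1 : M [] = 1) (hMmul : ∀ u v : List α, M (u ++ v) = M u * M v)
    (hrep : ∀ u : List α, p u = I ⬝ᵥ (M u *ᵥ T))
    (η : ℝ) (hη0 : 0 ≤ η) (hη1 : η ≤ 1)
    (Msig : Matrix (Fin d) (Fin d) ℝ) (hMsig : Msig = ∑ x : α, M [x])
    (hconv : HasSum (fun n : ℕ => η ^ n • Msig ^ n) (1 - η • Msig)⁻¹) :
    ∀ u : List α,
      (∑' x : List α, η ^ x.length * p (u ++ x)) = I ⬝ᵥ (M u *ᵥ ((1 - η • Msig)⁻¹ *ᵥ T)) := by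
  intro u
  have hsum : Summable fun x : List α => η ^ x.length * p (u ++ x) := by
    refine Summable.of_nonneg_of_le (fun x => mul_nonneg (pow_nonneg hη0 _) (hp0 _)) (fun x => ?_)
      (hp1.summable.comp_injective (List.append_right_injective u))
    exact mul_le_of_le_one_left (hp0 _) (pow_le_one₀ hη0 hη1)
  have hword : ∀ n : ℕ, ∑ v : Fin n → α, η ^ (List.ofFn v).length * p (u ++ List.ofFn v) =
      I ⬝ᵥ (M u *ᵥ ((η ^ n • Msig ^ n) *ᵥ T)) := by
    intro n
    rw [hMsig, ← sum_ofFn_eq_pow M hM1 hMmul n]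
    simp only [List.length_ofFn, hrep, hMmul, ← Matrix.mulVec_mulVec, Matrix.smul_mulVec,
      Matrix.mulVec_smul, dotProduct_smul, Matrix.sum_mulVec, Matrix.mulVec_sum, dotProduct_sum,
      Finset.smul_sum, smul_eq_mul]
  let φ : Matrix (Fin d) (Fin d) ℝ →+ ℝ :=
    { toFun := fun A => I ⬝ᵥ (M u *ᵥ (A *ᵥ T))
      map_zero' := by simp
      map_add' := fun A B => by simp [Matrix.add_mulVec, Matrix.mulVec_add] }
  have hφ : Continuous φ := by
    change Continuous fun A : Matrix (Fin d) (Fin d) ℝ => I ⬝ᵥ (M u *ᵥ (A *ᵥ T))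
    fun_prop
  have hlim : HasSum (fun n : ℕ => I ⬝ᵥ (M u *ᵥ ((η ^ n • Msig ^ n) *ᵥ T)))
      (I ⬝ᵥ (M u *ᵥ ((1 - η • Msig)⁻¹ *ᵥ T))) := hconv.map φ hφ
  have hsig := (List.equivSigmaTuple (α := α)).symm.summable_iff.mpr hsum
  rw [← (List.equivSigmaTuple (α := α)).symm.tsum_eq]
  refine (hsig.tsum_sigma).trans (Eq.trans (tsum_congr fun n => ?_) hlim.tsum_eq)
  rw [tsum_fintype]
  exact hword n
end

section
/- Let p be a stochastic language, let 0 ≤ η ≤ 1, let ξ be a random string distributed according to p, and let Z̄_η be the random bi-infinite matrix with entries Z̄_η[u,v] = ∑_{x∈Σ*} η^{|x|}·(1_{ξ=uvx} − p(uvx)) for u, v ∈ Σ*. Then for any strings u, u', v ∈ Σ*: |E(Z̄_η[u,v]·Z̄_η[u',v])| ≤ p̄_η(u'v). -/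
open MeasureTheory

/-- The weight `η ^ |x|` when `s = w ++ x`, and `0` when `w` is not a prefix of `s`. -/
noncomputable def prefixWeight {α : Type*} [DecidableEq α] (η : ℝ) (w s : List α) : ℝ :=
  ∑' x : List α, η ^ x.length * (if s = w ++ x then 1 else 0)

theorem hasFiniteSupport_prefixWeight_term {α : Type*} [DecidableEq α] (η : ℝ) (w s : List α) :
    (Function.support fun x : List α =>
      η ^ x.length * (if s = w ++ x then (1 : ℝ) else 0)).Finite := by
  refine Set.Subsingleton.finite fun x hx y hy => ?_
  have hx' : s = w ++ x := by
    by_contra h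
    simp [h] at hx
  have hy' : s = w ++ y := by
    by_contra h
    simp [h] at hy
  exact List.append_cancel_left (hx'.symm.trans hy')

theorem prefixWeight_nonneg {α : Type*} [DecidableEq α] {η : ℝ} (hη0 : 0 ≤ η) (w s : List α) :
    0 ≤ prefixWeight η w s :=
  tsum_nonneg fun x => mul_nonneg (pow_nonneg hη0 _) (by split_ifs <;> norm_num)

theorem prefixWeight_le_one {α : Type*} [DecidableEq α] {η : ℝ} (hη0 : 0 ≤ η) (hη1 : η ≤ 1)
    (w s : List α) : prefixWeight η w s ≤ 1 := by
  unfold prefixWeight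
  by_cases h : ∃ x, s = w ++ x
  · obtain ⟨x, rfl⟩ := h
    rw [tsum_eq_single x fun y hy => by simp [hy.symm]]
    simpa using pow_le_one₀ hη0 hη1
  · push Not at h
    simp [h]

theorem summable_pow_length_mul {α : Type*} {η : ℝ} (hη0 : 0 ≤ η) (hη1 : η ≤ 1)
    {p : List α → ℝ} (hp0 : ∀ w, 0 ≤ p w) (hp : Summable p) (w : List α) :
    Summable fun x : List α => η ^ x.length * p (w ++ x) :=
  Summable.of_nonneg_of_le (fun _ => mul_nonneg (pow_nonneg hη0 _) (hp0 _))
    (fun _ => mul_le_of_le_one_left (hp0 _) (pow_le_one₀ hη0 hη1))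
    (hp.comp_injective (List.append_right_injective w))

theorem integrable_prefixWeight {α Ω : Type*} [Countable α] [DecidableEq α]
    [MeasurableSpace Ω] (μ : Measure Ω) [IsFiniteMeasure μ] {η : ℝ} (hη0 : 0 ≤ η) (hη1 : η ≤ 1)
    {ξ : Ω → List α} (hmeas : ∀ w : List α, MeasurableSet {ω | ξ ω = w}) (w : List α) :
    Integrable (fun ω => prefixWeight η w (ξ ω)) μ := by
  let _ : MeasurableSpace (List α) := ⊤
  have hξ : Measurable ξ := measurable_to_countable' hmeas
  have hw : Measurable (prefixWeight η w) := measurable_from_top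
  refine Integrable.of_bound (hw.comp hξ).aestronglyMeasurable 1 (.of_forall fun ω => ?_)
  rw [Real.norm_of_nonneg (prefixWeight_nonneg hη0 _ _)]
  exact prefixWeight_le_one hη0 hη1 _ _

theorem integral_prefixWeight {α Ω : Type*} [Countable α] [DecidableEq α]
    [MeasurableSpace Ω] (μ : Measure Ω) [IsFiniteMeasure μ] {η : ℝ} (hη0 : 0 ≤ η) (hη1 : η ≤ 1)
    {p : List α → ℝ} (hp0 : ∀ w, 0 ≤ p w) (hp : Summable p)
    {ξ : Ω → List α} (hmeas : ∀ w : List α, MeasurableSet {ω | ξ ω = w})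
    (hdist : ∀ w : List α, μ {ω | ξ ω = w} = ENNReal.ofReal (p w)) (w : List α) :
    ∫ ω, prefixWeight η w (ξ ω) ∂μ = ∑' x : List α, η ^ x.length * p (w ++ x) := by
  have hind : ∀ s, (fun ω => if ξ ω = s then (1 : ℝ) else 0) =
      {ω | ξ ω = s}.indicator fun _ => 1 := fun s => by
    ext ω
    simp [Set.indicator_apply]
  have hint : ∀ s, Integrable (fun ω => if ξ ω = s then (1 : ℝ) else 0) μ := fun s => by
    rw [hind]
    exact (integrable_const 1).indicator (hmeas s)
  have hval : ∀ x : List α, ∫ ω, η ^ x.length * (if ξ ω = w ++ x then (1 : ℝ) else 0) ∂μ =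
      η ^ x.length * p (w ++ x) := fun x => by
    rw [integral_const_mul, hind, integral_indicator_const _ (hmeas _), measureReal_def, hdist,
      ENNReal.toReal_ofReal (hp0 _), smul_eq_mul, mul_one]
  have hnorm : ∀ (x : List α) ω, ‖η ^ x.length * (if ξ ω = w ++ x then (1 : ℝ) else 0)‖ =
      η ^ x.length * (if ξ ω = w ++ x then (1 : ℝ) else 0) := fun x ω =>
    Real.norm_of_nonneg (mul_nonneg (pow_nonneg hη0 _) (by split_ifs <;> norm_num))
  have hsum := hasSum_integral_of_summable_integral_norm
    (F := fun (x : List α) ω => η ^ x.length * (if ξ ω = w ++ x then (1 : ℝ) else 0)) (μ := μ)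
    (fun x => (hint _).const_mul _)
    (by simpa only [hnorm, hval] using summable_pow_length_mul hη0 hη1 hp0 hp w)
  simp only [hval] at hsum
  exact hsum.tsum_eq.symm

/-- The covariance of a `[0, 1]`-valued random variable and a nonnegative one is bounded in absolute
value by the mean of the latter. -/
theorem abs_integral_centered_mul_le {Ω : Type*} [MeasurableSpace Ω] (μ : Measure Ω)
    [IsProbabilityMeasure μ] {f g : Ω → ℝ} (hf : Integrable f μ) (hg : Integrable g μ)
    (hf0 : ∀ ω, 0 ≤ f ω) (hf1 : ∀ ω, f ω ≤ 1) (hg0 : ∀ ω, 0 ≤ g ω) :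
    |∫ ω, (f ω - ∫ ω, f ω ∂μ) * (g ω - ∫ ω, g ω ∂μ) ∂μ| ≤ ∫ ω, g ω ∂μ := by
  set a := ∫ ω, f ω ∂μ with ha
  set b := ∫ ω, g ω ∂μ with hb
  have ha0 : 0 ≤ a := integral_nonneg hf0
  have hb0 : 0 ≤ b := integral_nonneg hg0
  have ha1 : a ≤ 1 := by
    simpa using integral_mono hf (integrable_const (1 : ℝ)) hf1
  have hfg : Integrable (fun ω => f ω * g ω) μ :=
    hg.bdd_mul hf.aestronglyMeasurable
      (.of_forall fun ω => (Real.norm_of_nonneg (hf0 ω)).trans_le (hf1 ω))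
  have hfg0 : 0 ≤ ∫ ω, f ω * g ω ∂μ := integral_nonneg fun ω => mul_nonneg (hf0 ω) (hg0 ω)
  have hfg1 : ∫ ω, f ω * g ω ∂μ ≤ b :=
    integral_mono hfg hg fun ω => mul_le_of_le_one_left (hg0 ω) (hf1 ω)
  have hcov : ∫ ω, (f ω - a) * (g ω - b) ∂μ = ∫ ω, f ω * g ω ∂μ - a * b := by
    have hexp : ∀ ω, (f ω - a) * (g ω - b) = f ω * g ω - a * g ω - b * (f ω - a) :=
      fun ω => by ring
    simp only [hexp]
    have hag : Integrable (fun ω => f ω * g ω - a * g ω) μ := hfg.sub (hg.const_mul a)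
    have hbf : Integrable (fun ω => b * (f ω - a)) μ := (hf.sub (integrable_const a)).const_mul b
    rw [integral_sub hag hbf,
      integral_sub hfg (hg.const_mul a), integral_const_mul, integral_const_mul,
      integral_sub hf (integrable_const a)]
    simp [← ha, ← hb]
  have hab1 : a * b ≤ b := mul_le_of_le_one_left hb0 ha1
  have hab0 : 0 ≤ a * b := mul_nonneg ha0 hb0
  rw [hcov, abs_le]
  constructor <;> linarith

/-- for a stochastic language `p`, `0 ≤ η ≤ 1`, a random string `ξ ∼ p`
and the random bi-infinite matrix `Z̄_η[u,v] = ∑_x η^{|x|}·(1_{ξ=uvx} − p(uvx))`, one has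
`|E(Z̄_η[u,v]·Z̄_η[u',v])| ≤ p̄_η(u'v)` where `p̄_η(u) = ∑_x η^{|x|}·p(ux)`. -/
theorem prefix_hankel_entry_covariance_bound {α Ω : Type*} [Fintype α] [DecidableEq α]
    [MeasurableSpace Ω] (μ : Measure Ω) [IsProbabilityMeasure μ]
    (p : List α → ℝ) (hp0 : ∀ w, 0 ≤ p w) (hp1 : HasSum p 1)
    (η : ℝ) (hη0 : 0 ≤ η) (hη1 : η ≤ 1)
    (ξ : Ω → List α)
    (hmeas : ∀ w : List α, MeasurableSet {ω | ξ ω = w})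
    (hdist : ∀ w : List α, μ {ω | ξ ω = w} = ENNReal.ofReal (p w))
    (Z : Ω → List α → List α → ℝ)
    (hZ : ∀ ω u v, Z ω u v =
      ∑' x : List α, η ^ x.length *
        ((if ξ ω = u ++ v ++ x then 1 else 0) - p (u ++ v ++ x))) :
    ∀ u u' v : List α,
      |∫ ω, Z ω u v * Z ω u' v ∂μ| ≤ ∑' x : List α, η ^ x.length * p (u' ++ v ++ x) := by
  intro u u' v
  have hint : ∀ w, Integrable (fun ω => prefixWeight η w (ξ ω)) μ :=
    integrable_prefixWeight μ hη0 hη1 hmeas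
  have hmean : ∀ w, ∫ ω, prefixWeight η w (ξ ω) ∂μ = ∑' x : List α, η ^ x.length * p (w ++ x) :=
    integral_prefixWeight μ hη0 hη1 hp0 hp1.summable hmeas hdist
  have hZ_centered : ∀ ω u v, Z ω u v =
      prefixWeight η (u ++ v) (ξ ω) - ∫ ω, prefixWeight η (u ++ v) (ξ ω) ∂μ := fun ω u v => by
    rw [hZ, hmean, prefixWeight,
      ← (summable_of_hasFiniteSupport (hasFiniteSupport_prefixWeight_term η _ _)).tsum_sub
        (summable_pow_length_mul hη0 hη1 hp0 hp1.summable _)]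
    simp only [mul_sub]
  simp only [hZ_centered, ← hmean]
  exact abs_integral_centered_mul_le μ (hint _) (hint _)
    (fun ω => prefixWeight_nonneg hη0 _ _) (fun ω => prefixWeight_le_one hη0 hη1 _ _)
    (fun ω => prefixWeight_nonneg hη0 _ _)
end

section
/- Let p be a stochastic language, let 0 ≤ η ≤ 1 with S_{p̄_η}^{(2)} < ∞, let U, V be finite subsets of Σ*, let ξ be a random string distributed according to p, and let Z̄_η be the U×V random matrix Z̄_η[u,v] = ∑_{x∈Σ*} η^{|x|}·(1_{ξ=uvx} − p(uvx)). Then ‖E(Z̄_η·Z̄_ηᵀ)‖₂ ≤ S_{p̄_η}^{(2)}, tr(E(Z̄_η·Z̄_ηᵀ)) ≤ S_{p̄_η}^{(2)}, ‖E(Z̄_ηᵀ·Z̄_η)‖₂ ≤ S_{p̄_η}^{(2)}, and tr(E(Z̄_ηᵀ·Z̄_η)) ≤ S_{p̄_η}^{(2)}. -/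
open MeasureTheory Matrix

/-- A second-moment matrix `E(W Wᵀ)` has trace the sum of the second moments of the entries. -/
theorem trace_secondMoment {Ω m n : Type*} [MeasurableSpace Ω] {μ : Measure Ω}
    [Fintype m] [Fintype n] {W : Ω → Matrix m n ℝ}
    (hW : ∀ i j, MemLp (fun ω => W ω i j) 2 μ) {A : Matrix m m ℝ}
    (hA : ∀ i i', A i i' = ∫ ω, (W ω * (W ω)ᵀ) i i' ∂μ) :
    A.trace = ∑ i, ∑ j, ∫ ω, W ω i j ^ 2 ∂μ := by
  simp only [Matrix.trace, Matrix.diag_apply, hA, Matrix.mul_apply, Matrix.transpose_apply]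
  refine Finset.sum_congr rfl fun i _ => ?_
  simp only [← pow_two]
  exact integral_finsetSum _ fun j _ => (hW i j).integrable_sq

/-- The spectral norm of a second-moment matrix `E(W Wᵀ)` is at most its trace. -/
theorem specNorm_secondMoment_le_trace {Ω m n : Type*} [MeasurableSpace Ω] {μ : Measure Ω}
    [Fintype m] [DecidableEq m] [Fintype n] {W : Ω → Matrix m n ℝ}
    (hW : ∀ i j, MemLp (fun ω => W ω i j) 2 μ) {A : Matrix m m ℝ}
    (hA : ∀ i i', A i i' = ∫ ω, (W ω * (W ω)ᵀ) i i' ∂μ) :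
    specNorm A ≤ A.trace := by
  have htr := trace_secondMoment hW hA
  have htr0 : 0 ≤ A.trace := by
    rw [htr]
    exact Finset.sum_nonneg fun i _ => Finset.sum_nonneg fun j _ =>
      integral_nonneg fun ω => sq_nonneg _
  have hint : ∀ i i' j, Integrable (fun ω => W ω i j * W ω i' j) μ := fun i i' j =>
    (hW i j).integrable_mul (hW i' j)
  have hint2 : ∀ i j, Integrable (fun ω => W ω i j ^ 2) μ := fun i j => (hW i j).integrable_sq
  have key : ∀ x y : m → ℝ, ∑ i, y i * (A *ᵥ x) i ≤
      A.trace * (√(∑ i, y i ^ 2) * √(∑ i, x i ^ 2)) := by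
    intro x y
    have e1 : ∑ i, y i * (A *ᵥ x) i =
        ∫ ω, ∑ j, (∑ i, y i * W ω i j) * (∑ i, x i * W ω i j) ∂μ := by
      have : ∀ ω, ∑ j, (∑ i, y i * W ω i j) * (∑ i, x i * W ω i j) =
          ∑ i, ∑ i', ∑ j, y i * x i' * (W ω i j * W ω i' j) := by
        intro ω
        simp only [Finset.sum_mul_sum]
        rw [Finset.sum_comm]
        refine Finset.sum_congr rfl fun i _ => ?_
        rw [Finset.sum_comm]
        refine Finset.sum_congr rfl fun i' _ => Finset.sum_congr rfl fun j _ => ?_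
        ring
      simp only [this]
      rw [integral_finsetSum _ fun i _ => integrable_finsetSum _ fun i' _ =>
        integrable_finsetSum _ fun j _ => (hint i i' j).const_mul _]
      refine Finset.sum_congr rfl fun i _ => ?_
      rw [integral_finsetSum _ fun i' _ =>
        integrable_finsetSum _ fun j _ => (hint i i' j).const_mul _]
      rw [Matrix.mulVec, dotProduct, Finset.mul_sum]
      refine Finset.sum_congr rfl fun i' _ => ?_
      simp only [hA, Matrix.mul_apply, Matrix.transpose_apply]
      rw [integral_finsetSum _ fun j _ => hint i i' j,
        integral_finsetSum _ fun j _ => (hint i i' j).const_mul _]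
      simp only [integral_const_mul, ← Finset.mul_sum]
      ring
    have e2 : A.trace * (√(∑ i, y i ^ 2) * √(∑ i, x i ^ 2)) =
        ∫ ω, ∑ j, (∑ i, W ω i j ^ 2) * (√(∑ i, y i ^ 2) * √(∑ i, x i ^ 2)) ∂μ := by
      simp only [← Finset.sum_mul]
      rw [integral_mul_const, htr, integral_finsetSum _ fun j _ =>
        integrable_finsetSum _ fun i _ => hint2 i j, Finset.sum_comm]
      congr 1
      refine Finset.sum_congr rfl fun j _ => ?_
      rw [integral_finsetSum _ fun i _ => hint2 i j]
    rw [e1, e2]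
    refine integral_mono ?_ ?_ fun ω => Finset.sum_le_sum fun j _ => ?_
    · refine integrable_finsetSum _ fun j _ => ?_
      have h : ∀ z : m → ℝ, MemLp (fun ω => ∑ i, z i * W ω i j) 2 μ := fun z =>
        memLp_finsetSum _ fun i _ => (hW i j).const_mul _
      exact (h y).integrable_mul (h x)
    · exact integrable_finsetSum _ fun j _ =>
        (integrable_finsetSum _ fun i _ => hint2 i j).mul_const _
    · have cs : ∀ z : m → ℝ, |∑ i, z i * W ω i j| ≤ √(∑ i, z i ^ 2) * √(∑ i, W ω i j ^ 2) := by
        intro z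
        rw [← Real.sqrt_mul (Finset.sum_nonneg fun i _ => sq_nonneg _)]
        exact Real.abs_le_sqrt (Finset.sum_mul_sq_le_sq_mul_sq _ _ _)
      calc _ ≤ |∑ i, y i * W ω i j| * |∑ i, x i * W ω i j| := by
            rw [← abs_mul]; exact le_abs_self _
        _ ≤ (√(∑ i, y i ^ 2) * √(∑ i, W ω i j ^ 2)) *
            (√(∑ i, x i ^ 2) * √(∑ i, W ω i j ^ 2)) :=
            mul_le_mul (cs y) (cs x) (abs_nonneg _) (by positivity)
        _ = √(∑ i, W ω i j ^ 2) ^ 2 * (√(∑ i, y i ^ 2) * √(∑ i, x i ^ 2)) := by ring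
        _ = _ := by rw [Real.sq_sqrt (Finset.sum_nonneg fun i _ => sq_nonneg _)]
  refine ContinuousLinearMap.opNorm_le_bound _ htr0 fun x => ?_
  have h := key x.ofLp (A *ᵥ x.ofLp)
  have hn : ‖(Matrix.toEuclideanLin A).toContinuousLinearMap x‖ =
      √(∑ i, (A *ᵥ x.ofLp) i ^ 2) := by
    rw [EuclideanSpace.norm_eq]
    simp [Matrix.toLpLin_apply]
  have hx : ‖x‖ = √(∑ i, x.ofLp i ^ 2) := by
    rw [EuclideanSpace.norm_eq]
    simp
  rw [hn, hx]
  have hs : ∑ i, (A *ᵥ x.ofLp) i * (A *ᵥ x.ofLp) i = √(∑ i, (A *ᵥ x.ofLp) i ^ 2) ^ 2 := by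
    rw [Real.sq_sqrt (Finset.sum_nonneg fun i _ => sq_nonneg _)]
    simp only [pow_two]
  rw [hs] at h
  rcases (Real.sqrt_nonneg (∑ i, (A *ᵥ x.ofLp) i ^ 2)).eq_or_lt with h0 | h0
  · rw [← h0]; positivity
  · exact le_of_mul_le_mul_left (by linarith) h0

/-- At most one summand of `∑ₓ η^{|x|} 1_{w = s x}` is nonzero. -/
theorem hasSum_pow_length_ite_eq_append {α : Type*} [DecidableEq α] {η : ℝ}
    (hη0 : 0 ≤ η) (hη1 : η ≤ 1) (w s : List α) :
    ∃ c : ℝ, 0 ≤ c ∧ c ≤ 1 ∧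
      HasSum (fun x : List α => η ^ x.length * (if w = s ++ x then 1 else 0)) c := by
  by_cases h : ∃ x, w = s ++ x
  · obtain ⟨x, rfl⟩ := h
    refine ⟨η ^ x.length, by positivity, pow_le_one₀ hη0 hη1, ?_⟩
    convert hasSum_single x fun y hy => ?_ using 1
    · simp
    · simp [Ne.symm hy]
  · push Not at h
    exact ⟨0, le_rfl, zero_le_one, by simp [h, hasSum_zero]⟩

/-- The centred smoothed prefix indicator is square integrable, and its variance is at most the
smoothed prefix probability. -/
theorem memLp_and_integral_sq_centered_prefix_le {α Ω : Type*} [Countable α] [DecidableEq α]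
    [MeasurableSpace Ω] {μ : Measure Ω} [IsProbabilityMeasure μ]
    {p : List α → ℝ} (hp0 : ∀ w, 0 ≤ p w) (hp : Summable p)
    {η : ℝ} (hη0 : 0 ≤ η) (hη1 : η ≤ 1) {ξ : Ω → List α}
    (hmeas : ∀ w : List α, MeasurableSet {ω | ξ ω = w})
    (hdist : ∀ w : List α, μ {ω | ξ ω = w} = ENNReal.ofReal (p w)) (s : List α) :
    MemLp (fun ω => ∑' x : List α, η ^ x.length *
        ((if ξ ω = s ++ x then 1 else 0) - p (s ++ x))) 2 μ ∧
      ∫ ω, (∑' x : List α, η ^ x.length *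
        ((if ξ ω = s ++ x then 1 else 0) - p (s ++ x))) ^ 2 ∂μ ≤
      ∑' x : List α, η ^ x.length * p (s ++ x) := by
  choose f hf0 hf1 hf using fun w => hasSum_pow_length_ite_eq_append hη0 hη1 w s
  have hsum : Summable fun x : List α => η ^ x.length * p (s ++ x) :=
    Summable.of_nonneg_of_le (fun x => mul_nonneg (pow_nonneg hη0 _) (hp0 _))
      (fun x => mul_le_of_le_one_left (hp0 _) (pow_le_one₀ hη0 hη1))
      (hp.comp_injective (List.append_right_injective s))
  set q := ∑' x : List α, η ^ x.length * p (s ++ x)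
  have hZ : ∀ ω, ∑' x : List α, η ^ x.length *
      ((if ξ ω = s ++ x then 1 else 0) - p (s ++ x)) = f (ξ ω) - q := by
    intro ω
    simp only [mul_sub]
    exact ((hf (ξ ω)).sub hsum.hasSum).tsum_eq
  simp only [hZ]
  have hfm : Measurable fun ω => f (ξ ω) := by
    let _ : MeasurableSpace (List α) := ⊤
    have hξ : Measurable ξ := measurable_to_countable' hmeas
    exact measurable_from_top.comp hξ
  have hfL : MemLp (fun ω => f (ξ ω)) 2 μ :=
    MemLp.of_bound hfm.aestronglyMeasurable 1
      (ae_of_all _ fun ω => by rw [Real.norm_eq_abs, abs_of_nonneg (hf0 _)]; exact hf1 _)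
  have hfi : Integrable (fun ω => f (ξ ω)) μ := hfL.integrable one_le_two
  have hind : ∀ x : List α, (fun ω => η ^ x.length * (if ξ ω = s ++ x then (1 : ℝ) else 0)) =
      {ω | ξ ω = s ++ x}.indicator fun _ => η ^ x.length := by
    intro x
    ext ω
    simp [Set.indicator_apply]
  have hval : ∀ x : List α,
      ∫ ω, η ^ x.length * (if ξ ω = s ++ x then (1 : ℝ) else 0) ∂μ = η ^ x.length * p (s ++ x) := by
    intro x
    rw [hind, integral_indicator_const _ (hmeas _), Measure.real, hdist,
      ENNReal.toReal_ofReal (hp0 _), smul_eq_mul, mul_comm]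
  have hmean : ∫ ω, f (ξ ω) ∂μ = q := by
    have h := integral_tsum_of_summable_integral_norm (μ := μ)
      (F := fun (x : List α) ω => η ^ x.length * (if ξ ω = s ++ x then (1 : ℝ) else 0))
      (fun x => by
        rw [hind]
        exact (integrable_const _).indicator (hmeas _))
      (by
        refine hsum.congr fun x => ?_
        rw [← hval]
        refine integral_congr_ae (ae_of_all _ fun ω => ?_)
        refine (Real.norm_of_nonneg (mul_nonneg (pow_nonneg hη0 _) ?_)).symm
        split_ifs <;> simp)
    simp only [hval, (hf _).tsum_eq] at h
    exact h.symm
  refine ⟨hfL.sub (memLp_const q), ?_⟩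
  calc ∫ ω, (f (ξ ω) - q) ^ 2 ∂μ ≤ ∫ ω, (f (ξ ω) - (2 * q * f (ξ ω) - q ^ 2)) ∂μ := by
        refine integral_mono (hfL.sub (memLp_const q)).integrable_sq
          (hfi.sub ((hfi.const_mul _).sub (integrable_const _))) fun ω => ?_
        have := mul_nonneg (hf0 (ξ ω)) (sub_nonneg.2 (hf1 (ξ ω)))
        dsimp only
        nlinarith
    _ = q - q ^ 2 := by
        have hl : Integrable (fun ω => 2 * q * f (ξ ω) - q ^ 2) μ :=
          (hfi.const_mul _).sub (integrable_const _)
        rw [integral_sub hfi hl, integral_sub (hfi.const_mul _) (integrable_const _), integral_const_mul, hmean]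
        simp
        ring
    _ ≤ q := sub_le_self _ (sq_nonneg q)

/-- for a stochastic language `p`, `0 ≤ η ≤ 1` with
`S_{p̄_η}⁽²⁾ = ∑_{u,v} p̄_η(uv) < ∞`, finite `U, V ⊆ Σ*`, a random string `ξ ∼ p` and the
`U × V` random matrix `Z̄_η[u,v] = ∑_x η^{|x|}·(1_{ξ=uvx} − p(uvx))`, the matrices
`E(Z̄_η·Z̄_ηᵀ)` and `E(Z̄_ηᵀ·Z̄_η)` (expectations taken entrywise) have spectral norm and
trace bounded by `S_{p̄_η}⁽²⁾`. -/
theorem prefix_hankel_expected_square_bound {α Ω : Type*} [Fintype α] [DecidableEq α]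
    [MeasurableSpace Ω] (μ : Measure Ω) [IsProbabilityMeasure μ]
    (p : List α → ℝ) (hp0 : ∀ w, 0 ≤ p w) (hp1 : HasSum p 1)
    (η : ℝ) (hη0 : 0 ≤ η) (hη1 : η ≤ 1)
    (hS2 : Summable fun z : List α × List α =>
      ∑' x : List α, η ^ x.length * p (z.1 ++ z.2 ++ x))
    (U V : Finset (List α))
    (ξ : Ω → List α)
    (hmeas : ∀ w : List α, MeasurableSet {ω | ξ ω = w})
    (hdist : ∀ w : List α, μ {ω | ξ ω = w} = ENNReal.ofReal (p w))
    (Z : Ω → Matrix ↥U ↥V ℝ)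
    (hZ : ∀ ω (u : ↥U) (v : ↥V), Z ω u v =
      ∑' x : List α, η ^ x.length *
        ((if ξ ω = ↑u ++ ↑v ++ x then 1 else 0) - p (↑u ++ ↑v ++ x)))
    (A : Matrix ↥U ↥U ℝ) (hA : ∀ u u', A u u' = ∫ ω, (Z ω * (Z ω)ᵀ) u u' ∂μ)
    (B : Matrix ↥V ↥V ℝ) (hB : ∀ v v', B v v' = ∫ ω, ((Z ω)ᵀ * Z ω) v v' ∂μ) :
    specNorm A ≤ ∑' z : List α × List α, ∑' x : List α, η ^ x.length * p (z.1 ++ z.2 ++ x) ∧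
    Matrix.trace A ≤ ∑' z : List α × List α, ∑' x : List α, η ^ x.length * p (z.1 ++ z.2 ++ x) ∧
    specNorm B ≤ ∑' z : List α × List α, ∑' x : List α, η ^ x.length * p (z.1 ++ z.2 ++ x) ∧
    Matrix.trace B ≤ ∑' z : List α × List α, ∑' x : List α, η ^ x.length * p (z.1 ++ z.2 ++ x) := by
  have hE : ∀ (u : ↥U) (v : ↥V), MemLp (fun ω => Z ω u v) 2 μ ∧
      ∫ ω, Z ω u v ^ 2 ∂μ ≤ ∑' x : List α, η ^ x.length * p (↑u ++ ↑v ++ x) := by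
    intro u v
    simp only [hZ]
    exact memLp_and_integral_sq_centered_prefix_le hp0 hp1.summable hη0 hη1 hmeas hdist _
  have hS : ∑ u : ↥U, ∑ v : ↥V, ∫ ω, Z ω u v ^ 2 ∂μ ≤
      ∑' z : List α × List α, ∑' x : List α, η ^ x.length * p (z.1 ++ z.2 ++ x) := by
    calc _ ≤ ∑ u : ↥U, ∑ v : ↥V, ∑' x : List α, η ^ x.length * p (↑u ++ ↑v ++ x) :=
          Finset.sum_le_sum fun u _ => Finset.sum_le_sum fun v _ => (hE u v).2
      _ = ∑ z ∈ U ×ˢ V, ∑' x : List α, η ^ x.length * p (z.1 ++ z.2 ++ x) := by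
          rw [Finset.sum_product, ← Finset.sum_coe_sort U]
          refine Finset.sum_congr rfl fun u _ => ?_
          rw [← Finset.sum_coe_sort V]
      _ ≤ _ := hS2.sum_le_tsum _ fun z _ =>
          tsum_nonneg fun x => mul_nonneg (pow_nonneg hη0 _) (hp0 _)
  have hWA : ∀ u v, MemLp (fun ω => Z ω u v) 2 μ := fun u v => (hE u v).1
  have hWB : ∀ v u, MemLp (fun ω => (Z ω)ᵀ v u) 2 μ := fun v u => (hE u v).1
  have hB' : ∀ v v', B v v' = ∫ ω, ((Z ω)ᵀ * (Z ω)ᵀᵀ) v v' ∂μ := hB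
  have htA := (trace_secondMoment hWA hA).trans_le hS
  have htB : B.trace ≤ ∑' z : List α × List α, ∑' x : List α,
      η ^ x.length * p (z.1 ++ z.2 ++ x) := by
    rw [trace_secondMoment hWB hB', Finset.sum_comm]
    exact hS
  exact ⟨(specNorm_secondMoment_le_trace hWA hA).trans htA, htA,
    (specNorm_secondMoment_le_trace hWB hB').trans htB, htB⟩
end

section
/- Let p be a stochastic language, let 0 < η < 1 with S_{p̂_η}^{(2)} < ∞, let U, V be finite subsets of Σ*, let ξ be a random string distributed according to p, and let Ẑ_η be the U×V random matrix Ẑ_η[u,v] = ∑_{x,y∈Σ*} η^{|x|+|y|}·(1_{ξ=xuvy} − p(xuvy)). Then ‖E(Ẑ_η·Ẑ_ηᵀ)‖₂ ≤ K_η·S_{p̂_η}^{(2)}, tr(E(Ẑ_η·Ẑ_ηᵀ)) ≤ K_η·S_{p̂_η}^{(2)}, ‖E(Ẑ_ηᵀ·Ẑ_η)‖₂ ≤ K_η·S_{p̂_η}^{(2)}, and tr(E(Ẑ_ηᵀ·Ẑ_η)) ≤ K_η·S_{p̂_η}^{(2)}. -/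
open MeasureTheory Matrix

/-- `K_η = 1` if `η ≤ e⁻¹`, and `K_η = (−e·η·ln η)⁻¹` otherwise. -/
noncomputable def Keta (η : ℝ) : ℝ :=
  if η ≤ (Real.exp 1)⁻¹ then 1 else (-(Real.exp 1 * η * Real.log η))⁻¹

lemma add_one_mul_pow_le_Keta {η : ℝ} (hη0 : 0 < η) (hη1 : η < 1) (n : ℕ) :
    ((n : ℝ) + 1) * η ^ n ≤ Keta η := by
  unfold Keta
  split_ifs with h
  · have hb : (n : ℝ) + 1 ≤ Real.exp 1 ^ n := by
      rw [← Real.exp_nat_mul, mul_one]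
      exact Real.add_one_le_exp _
    calc ((n : ℝ) + 1) * η ^ n ≤ Real.exp 1 ^ n * (Real.exp 1)⁻¹ ^ n := by gcongr
      _ = 1 := by rw [← mul_pow, mul_inv_cancel₀ (Real.exp_ne_zero 1), one_pow]
  · have hlog : Real.log η < 0 := Real.log_neg hη0 hη1
    have hpos : 0 < -(Real.exp 1 * η * Real.log η) := by
      have : 0 < Real.exp 1 * η := by positivity
      nlinarith
    rw [← one_div, le_div_iff₀ hpos]
    have hexp : -((n : ℝ) + 1) * Real.log η ≤ Real.exp (-((n : ℝ) + 1) * Real.log η - 1) := by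
      linarith [Real.add_one_le_exp (-((n : ℝ) + 1) * Real.log η - 1)]
    have hpow : η ^ (n + 1) = Real.exp (((n : ℝ) + 1) * Real.log η) := by
      rw [← Real.exp_log (pow_pos hη0 (n + 1)), Real.log_pow]
      push_cast
      rfl
    calc ((n : ℝ) + 1) * η ^ n * -(Real.exp 1 * η * Real.log η)
        = (-((n : ℝ) + 1) * Real.log η) * (Real.exp 1 * η ^ (n + 1)) := by ring
      _ ≤ Real.exp (-((n : ℝ) + 1) * Real.log η - 1) * (Real.exp 1 * η ^ (n + 1)) := by gcongr
      _ = 1 := by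
        rw [hpow, ← Real.exp_add, ← Real.exp_add, ← Real.exp_zero]
        ring_nf

lemma one_le_Keta {η : ℝ} (hη0 : 0 < η) (hη1 : η < 1) : 1 ≤ Keta η := by
  simpa using add_one_mul_pow_le_Keta hη0 hη1 0

/-- The occurrences of `u ++ v` as a factor of `w`, each discounted by the lengths of the prefix
and of the suffix around it. -/
noncomputable def discountedOccurrences {α : Type*} [DecidableEq α] (η : ℝ) (u v w : List α) : ℝ :=
  ∑' z : List α × List α,
    η ^ (z.1.length + z.2.length) * (if w = z.1 ++ u ++ v ++ z.2 then 1 else 0)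

section Occurrences

variable {α : Type*} [DecidableEq α] {η : ℝ}

lemma sum_discounted_le_Keta (hη0 : 0 < η) (hη1 : η < 1) (u v w : List α)
    (s : Finset (List α × List α)) :
    ∑ z ∈ s, η ^ (z.1.length + z.2.length) * (if w = z.1 ++ u ++ v ++ z.2 then (1 : ℝ) else 0)
      ≤ Keta η := by
  set n := w.length - u.length - v.length
  set t := s.filter fun z => w = z.1 ++ u ++ v ++ z.2
  have hlen : ∀ z ∈ t, z.1.length + z.2.length = n := by
    intro z hz
    have := congrArg List.length (Finset.mem_filter.1 hz).2
    simp only [List.length_append] at this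
    omega
  have hcard : t.card ≤ n + 1 := by
    rw [← Finset.card_range (n + 1)]
    refine Finset.card_le_card_of_injOn (fun z => z.1.length) ?_ ?_
    · intro z hz
      have := hlen z hz
      simp only [Finset.coe_range, Set.mem_Iio]
      omega
    · intro z hz z' hz' h
      have e : z.1 ++ (u ++ v ++ z.2) = z'.1 ++ (u ++ v ++ z'.2) := by
        simpa using (Finset.mem_filter.1 hz).2.symm.trans (Finset.mem_filter.1 hz').2
      obtain ⟨h1, h2⟩ := List.append_inj e h
      exact Prod.ext h1 (List.append_cancel_left h2)
  calc _ = ∑ z ∈ t, η ^ (z.1.length + z.2.length) := by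
        simp only [mul_ite, mul_one, mul_zero, t, Finset.sum_filter]
    _ = t.card * η ^ n := by
        rw [Finset.sum_congr rfl fun z hz => by rw [hlen z hz], Finset.sum_const, nsmul_eq_mul]
    _ ≤ ((n : ℝ) + 1) * η ^ n := by
        gcongr
        exact_mod_cast hcard
    _ ≤ Keta η := add_one_mul_pow_le_Keta hη0 hη1 n

lemma discounted_nonneg (hη0 : 0 < η) (u v w : List α) (z : List α × List α) :
    0 ≤ η ^ (z.1.length + z.2.length) *
      (if w = z.1 ++ u ++ v ++ z.2 then (1 : ℝ) else 0) := by
  split_ifs <;> positivity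

lemma summable_discounted (hη0 : 0 < η) (hη1 : η < 1) (u v w : List α) :
    Summable fun z : List α × List α => η ^ (z.1.length + z.2.length) *
      (if w = z.1 ++ u ++ v ++ z.2 then (1 : ℝ) else 0) :=
  summable_of_sum_le (discounted_nonneg hη0 u v w) (sum_discounted_le_Keta hη0 hη1 u v w)

lemma discountedOccurrences_nonneg (hη0 : 0 < η) (u v w : List α) :
    0 ≤ discountedOccurrences η u v w :=
  tsum_nonneg (discounted_nonneg hη0 u v w)

lemma discountedOccurrences_le_Keta (hη0 : 0 < η) (hη1 : η < 1) (u v w : List α) :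
    discountedOccurrences η u v w ≤ Keta η :=
  (summable_discounted hη0 hη1 u v w).tsum_le_of_sum_le (sum_discounted_le_Keta hη0 hη1 u v w)

/-- The smoothed factor function is the `p`-weighted sum of the discounted occurrences. -/
lemma hasSum_smoothed {p : List α → ℝ} (hp0 : ∀ w, 0 ≤ p w) (hp : Summable p)
    (hη0 : 0 < η) (hη1 : η < 1) (u v : List α) :
    HasSum (fun z : List α × List α =>
        η ^ (z.1.length + z.2.length) * p (z.1 ++ u ++ v ++ z.2))
      (∑' w, p w * discountedOccurrences η u v w) := by
  let F : List α × (List α × List α) → ℝ := fun q => p q.1 * (η ^ (q.2.1.length + q.2.2.length) *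
    (if q.1 = q.2.1 ++ u ++ v ++ q.2.2 then 1 else 0))
  have hF0 : 0 ≤ F := fun q => mul_nonneg (hp0 _) (discounted_nonneg hη0 u v _ _)
  have hrow : ∀ w, HasSum (fun z => F (w, z)) (p w * discountedOccurrences η u v w) := fun w =>
    (summable_discounted hη0 hη1 u v w).hasSum.mul_left (p w)
  have hF : Summable F := by
    refine (summable_prod_of_nonneg hF0).2 ⟨fun w => (hrow w).summable, ?_⟩
    simp only [fun w => (hrow w).tsum_eq]
    exact (hp.mul_right (Keta η)).of_nonneg_of_le
      (fun w => mul_nonneg (hp0 w) (discountedOccurrences_nonneg hη0 u v w))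
      fun w => mul_le_mul_of_nonneg_left (discountedOccurrences_le_Keta hη0 hη1 u v w) (hp0 w)
  have hcol : ∀ z : List α × List α, HasSum (fun w => F (w, z))
      (η ^ (z.1.length + z.2.length) * p (z.1 ++ u ++ v ++ z.2)) := by
    intro z
    convert hasSum_single (z.1 ++ u ++ v ++ z.2) (f := fun w => F (w, z)) ?_ using 1
    · simp only [F, if_true]
      ring
    · intro w hw
      simp only [F, if_neg hw, mul_zero]
  have htotal : ∑' q, F q = ∑' w, p w * discountedOccurrences η u v w := by
    rw [hF.tsum_prod]
    exact tsum_congr fun w => (hrow w).tsum_eq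
  rw [← htotal]
  exact ((Equiv.prodComm _ _).hasSum_iff.2 hF.hasSum).prod_fiberwise hcol

end Occurrences

lemma integral_comp_eq_tsum {β Ω : Type*} [Countable β] [MeasurableSpace Ω] (μ : Measure Ω)
    [IsProbabilityMeasure μ] {p : β → ℝ} (hp0 : ∀ w, 0 ≤ p w) {ξ : Ω → β}
    (hmeas : ∀ w, MeasurableSet {ω | ξ ω = w})
    (hdist : ∀ w, μ {ω | ξ ω = w} = ENNReal.ofReal (p w)) (f : β → ℝ)
    (hf : Integrable (fun ω => f (ξ ω)) μ) : ∫ ω, f (ξ ω) ∂μ = ∑' w, p w * f w := by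
  let _ : MeasurableSpace β := ⊤
  have hξ : Measurable ξ := measurable_to_countable' hmeas
  have hf' : Measurable f := measurable_from_top
  rw [← integral_map hξ.aemeasurable hf'.aestronglyMeasurable, integral_countable]
  · refine tsum_congr fun w => ?_
    have : ξ ⁻¹' {w} = {ω | ξ ω = w} := rfl
    rw [Measure.real, Measure.map_apply hξ trivial, this, hdist, ENNReal.toReal_ofReal (hp0 w),
      smul_eq_mul]
  · exact (integrable_map_measure hf'.aestronglyMeasurable hξ.aemeasurable).2 hf

lemma measurable_comp_of_countable {β Ω : Type*} [Countable β] [MeasurableSpace Ω] {ξ : Ω → β}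
    (hmeas : ∀ w, MeasurableSet {ω | ξ ω = w}) (f : β → ℝ) : Measurable fun ω => f (ξ ω) := by
  let _ : MeasurableSpace β := ⊤
  have hf : Measurable f := measurable_from_top
  exact hf.comp (measurable_to_countable' hmeas)

/-- A real function with values in `[0, K]` has variance at most `K` times its mean. -/
lemma integral_sub_integral_sq_le {Ω : Type*} [MeasurableSpace Ω] (μ : Measure Ω)
    [IsProbabilityMeasure μ] {X : Ω → ℝ} {K : ℝ} (hX : Measurable X) (hX0 : ∀ ω, 0 ≤ X ω)
    (hXK : ∀ ω, X ω ≤ K) : ∫ ω, (X ω - ∫ ω', X ω' ∂μ) ^ 2 ∂μ ≤ K * ∫ ω, X ω ∂μ := by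
  set c := ∫ ω, X ω ∂μ with hc
  have hXint : Integrable X μ := Integrable.of_bound hX.aestronglyMeasurable K
    (.of_forall fun ω => by rw [Real.norm_of_nonneg (hX0 ω)]; exact hXK ω)
  have hlin : Integrable (fun ω => (K - 2 * c) * X ω + c ^ 2) μ :=
    (hXint.const_mul _).add (integrable_const _)
  calc ∫ ω, (X ω - c) ^ 2 ∂μ ≤ ∫ ω, ((K - 2 * c) * X ω + c ^ 2) ∂μ := by
        refine integral_mono_of_nonneg (.of_forall fun ω => sq_nonneg _) hlin
          (.of_forall fun ω => ?_)
        have := mul_le_mul_of_nonneg_right (hXK ω) (hX0 ω)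
        change (X ω - c) ^ 2 ≤ (K - 2 * c) * X ω + c ^ 2
        linarith
    _ = (K - 2 * c) * c + c ^ 2 := by
        rw [integral_add (hXint.const_mul _) (integrable_const _), integral_const_mul, ← hc]
        simp
    _ ≤ K * c := by nlinarith [sq_nonneg c]

lemma specNorm_le_trace {m : Type*} [Fintype m] [DecidableEq m] {A : Matrix m m ℝ}
    (hdiag : ∀ i, 0 ≤ A i i) (hA : ∀ i j, A i j ^ 2 ≤ A i i * A j j) :
    specNorm A ≤ Matrix.trace A := by
  have htr : 0 ≤ Matrix.trace A := Finset.sum_nonneg fun i _ => hdiag i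
  refine ContinuousLinearMap.opNorm_le_bound _ htr fun x => ?_
  refine abs_le_of_sq_le_sq' ?_ (by positivity) |>.2
  rw [mul_pow, EuclideanSpace.norm_sq_eq, EuclideanSpace.norm_sq_eq]
  calc ∑ i, ‖(Matrix.toEuclideanLin A).toContinuousLinearMap x i‖ ^ 2
      = ∑ i, (∑ j, A i j * x j) ^ 2 := by
        refine Finset.sum_congr rfl fun i _ => ?_
        rw [Real.norm_eq_abs, sq_abs]
        rfl
    _ ≤ ∑ i, (∑ j, A i j ^ 2) * ∑ j, x j ^ 2 :=
        Finset.sum_le_sum fun i _ => Finset.sum_mul_sq_le_sq_mul_sq _ _ _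
    _ ≤ ∑ i, (∑ j, A i i * A j j) * ∑ j, x j ^ 2 := by
        gcongr with i _ j _
        exact hA i j
    _ = Matrix.trace A ^ 2 * ∑ j, ‖x j‖ ^ 2 := by
        simp only [Real.norm_eq_abs, sq_abs, ← Finset.sum_mul, ← Finset.mul_sum, Matrix.trace,
          Matrix.diag_apply, sq (∑ i, A i i)]

/-- The expectation of `Z * Zᵀ` has spectral norm at most its trace, and the trace is the sum of
the second moments of the entries of `Z`. -/
lemma specNorm_trace_of_integral_mul_transpose {m n Ω : Type*} [Fintype m] [DecidableEq m]
    [Fintype n] [MeasurableSpace Ω] (μ : Measure Ω) {Z : Ω → Matrix m n ℝ}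
    (hZ : ∀ i j, MemLp (fun ω => Z ω i j) 2 μ) {A : Matrix m m ℝ}
    (hA : ∀ i i', A i i' = ∫ ω, (Z ω * (Z ω)ᵀ) i i' ∂μ) :
    specNorm A ≤ Matrix.trace A ∧ Matrix.trace A = ∑ i, ∑ j, ∫ ω, Z ω i j ^ 2 ∂μ := by
  have hentry : ∀ i i', Integrable (fun ω => (Z ω * (Z ω)ᵀ) i i') μ := fun i i' =>
    integrable_finsetSum _ fun j _ => (hZ i j).integrable_mul (hZ i' j)
  have hquad : ∀ i i' (t : ℝ), 0 ≤ A i i * (t * t) + 2 * A i i' * t + A i' i' := by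
    intro i i' t
    have : A i i * (t * t) + 2 * A i i' * t + A i' i' =
        ∫ ω, ∑ j, (t * Z ω i j + Z ω i' j) ^ 2 ∂μ := by
      have e : ∀ ω, ∑ j, (t * Z ω i j + Z ω i' j) ^ 2 =
          (t * t) * (Z ω * (Z ω)ᵀ) i i + (2 * t) * (Z ω * (Z ω)ᵀ) i i' +
            (Z ω * (Z ω)ᵀ) i' i' := by
        intro ω
        simp only [Matrix.mul_apply, Matrix.transpose_apply, Finset.mul_sum,
          ← Finset.sum_add_distrib]
        exact Finset.sum_congr rfl fun j _ => by ring
      simp only [e]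
      have hlin : Integrable (fun ω => (t * t) * (Z ω * (Z ω)ᵀ) i i +
          (2 * t) * (Z ω * (Z ω)ᵀ) i i') μ :=
        ((hentry i i).const_mul _).add ((hentry i i').const_mul _)
      rw [integral_add hlin (hentry i' i'), integral_add ((hentry i i).const_mul _) ((hentry i i').const_mul _),
        integral_const_mul, integral_const_mul, ← hA, ← hA, ← hA]
      ring
    rw [this]
    exact integral_nonneg fun ω => Finset.sum_nonneg fun j _ => sq_nonneg _
  refine ⟨specNorm_le_trace (fun i => by simpa using hquad i i 0) fun i i' => ?_, ?_⟩
  · have := discrim_le_zero (hquad i i')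
    rw [discrim] at this
    linarith
  · refine Finset.sum_congr rfl fun i _ => ?_
    rw [Matrix.diag_apply, hA]
    simp only [Matrix.mul_apply, Matrix.transpose_apply, ← sq]
    exact integral_finsetSum _ fun j _ => (hZ i j).integrable_sq

/-- for a stochastic language `p`, `0 < η < 1` with
`S_{p̂_η}⁽²⁾ = ∑_{u,v} p̂_η(uv) < ∞`, finite `U, V ⊆ Σ*`, a random string `ξ ∼ p` and the
`U × V` random matrix `Ẑ_η[u,v] = ∑_{x,y} η^{|x|+|y|}·(1_{ξ=xuvy} − p(xuvy))`, the
matrices `E(Ẑ_η·Ẑ_ηᵀ)` and `E(Ẑ_ηᵀ·Ẑ_η)` (expectations taken entrywise) have spectral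
norm and trace bounded by `K_η·S_{p̂_η}⁽²⁾`. -/
theorem factor_hankel_expected_square_bound {α Ω : Type*} [Fintype α] [DecidableEq α]
    [MeasurableSpace Ω] (μ : Measure Ω) [IsProbabilityMeasure μ]
    (p : List α → ℝ) (hp0 : ∀ w, 0 ≤ p w) (hp1 : HasSum p 1)
    (η : ℝ) (hη0 : 0 < η) (hη1 : η < 1)
    (hS2 : Summable fun z : List α × List α =>
      ∑' y : List α × List α, η ^ (y.1.length + y.2.length) * p (y.1 ++ z.1 ++ z.2 ++ y.2))
    (U V : Finset (List α))
    (ξ : Ω → List α)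
    (hmeas : ∀ w : List α, MeasurableSet {ω | ξ ω = w})
    (hdist : ∀ w : List α, μ {ω | ξ ω = w} = ENNReal.ofReal (p w))
    (Z : Ω → Matrix ↥U ↥V ℝ)
    (hZ : ∀ ω (u : ↥U) (v : ↥V), Z ω u v =
      ∑' z : List α × List α, η ^ (z.1.length + z.2.length) *
        ((if ξ ω = z.1 ++ ↑u ++ ↑v ++ z.2 then 1 else 0) - p (z.1 ++ ↑u ++ ↑v ++ z.2)))
    (A : Matrix ↥U ↥U ℝ) (hA : ∀ u u', A u u' = ∫ ω, (Z ω * (Z ω)ᵀ) u u' ∂μ)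
    (B : Matrix ↥V ↥V ℝ) (hB : ∀ v v', B v v' = ∫ ω, ((Z ω)ᵀ * Z ω) v v' ∂μ) :
    specNorm A ≤ Keta η * ∑' z : List α × List α,
        ∑' y : List α × List α, η ^ (y.1.length + y.2.length) * p (y.1 ++ z.1 ++ z.2 ++ y.2) ∧
    Matrix.trace A ≤ Keta η * ∑' z : List α × List α,
        ∑' y : List α × List α, η ^ (y.1.length + y.2.length) * p (y.1 ++ z.1 ++ z.2 ++ y.2) ∧
    specNorm B ≤ Keta η * ∑' z : List α × List α,
        ∑' y : List α × List α, η ^ (y.1.length + y.2.length) * p (y.1 ++ z.1 ++ z.2 ++ y.2) ∧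
    Matrix.trace B ≤ Keta η * ∑' z : List α × List α,
        ∑' y : List α × List α, η ^ (y.1.length + y.2.length) * p (y.1 ++ z.1 ++ z.2 ++ y.2) := by
  set P : List α × List α → ℝ := fun z => ∑' y : List α × List α,
    η ^ (y.1.length + y.2.length) * p (y.1 ++ z.1 ++ z.2 ++ y.2)
  let X : ↥U → ↥V → Ω → ℝ := fun u v ω => discountedOccurrences η ↑u ↑v (ξ ω)
  have hX : ∀ u v, Measurable (X u v) := fun u v => measurable_comp_of_countable hmeas _
  have hX0 : ∀ u v ω, 0 ≤ X u v ω := fun u v ω => discountedOccurrences_nonneg hη0 _ _ _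
  have hXK : ∀ u v ω, X u v ω ≤ Keta η := fun u v ω => discountedOccurrences_le_Keta hη0 hη1 _ _ _
  have hXnorm : ∀ u v ω, ‖X u v ω‖ ≤ Keta η := fun u v ω => by
    rw [Real.norm_of_nonneg (hX0 u v ω)]
    exact hXK u v ω
  have hsum := fun u v : List α => hasSum_smoothed hp0 hp1.summable hη0 hη1 u v
  have hmean : ∀ (u : ↥U) (v : ↥V), ∫ ω, X u v ω ∂μ = P (↑u, ↑v) := fun u v =>
    (integral_comp_eq_tsum μ hp0 hmeas hdist _ (Integrable.of_bound
      (hX u v).aestronglyMeasurable (Keta η) (.of_forall (hXnorm u v)))).trans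
      (hsum ↑u ↑v).tsum_eq.symm
  have hZX : ∀ ω u v, Z ω u v = X u v ω - ∫ ω', X u v ω' ∂μ := by
    intro ω u v
    rw [hZ, hmean]
    simp only [mul_sub]
    exact (summable_discounted hη0 hη1 _ _ _).tsum_sub (hsum _ _).summable
  have hmem : ∀ u v, MemLp (fun ω => Z ω u v) 2 μ := by
    intro u v
    simp only [hZX]
    exact (MemLp.of_bound (hX u v).aestronglyMeasurable (Keta η)
      (.of_forall (hXnorm u v))).sub (memLp_const _)
  have hsq : ∀ u v, ∫ ω, Z ω u v ^ 2 ∂μ ≤ Keta η * P (↑u, ↑v) := by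
    intro u v
    simp only [hZX, ← hmean]
    exact integral_sub_integral_sq_le μ (hX u v) (hX0 u v) (hXK u v)
  have hbound : ∑ u, ∑ v, ∫ ω, Z ω u v ^ 2 ∂μ ≤ Keta η * ∑' z, P z := by
    calc _ ≤ ∑ u : ↥U, ∑ v : ↥V, Keta η * P (↑u, ↑v) :=
          Finset.sum_le_sum fun u _ => Finset.sum_le_sum fun v _ => hsq u v
      _ = Keta η * ∑ z ∈ U ×ˢ V, P z := by
          rw [Finset.sum_product, ← Finset.sum_coe_sort U, Finset.mul_sum]
          refine Finset.sum_congr rfl fun u _ => ?_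
          rw [← Finset.sum_coe_sort V, Finset.mul_sum]
      _ ≤ Keta η * ∑' z, P z := by
          refine mul_le_mul_of_nonneg_left (hS2.sum_le_tsum _ fun z _ => ?_)
            (zero_le_one.trans (one_le_Keta hη0 hη1))
          exact tsum_nonneg fun y => mul_nonneg (pow_nonneg hη0.le _) (hp0 _)
  obtain ⟨hA₁, hA₂⟩ := specNorm_trace_of_integral_mul_transpose μ hmem hA
  obtain ⟨hB₁, hB₂⟩ := specNorm_trace_of_integral_mul_transpose μ
    (Z := fun ω => (Z ω)ᵀ) (fun v u => hmem u v) hB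
  have hA₃ := hA₂.trans_le hbound
  have hB₃ := hB₂.trans_le (Finset.sum_comm.trans_le hbound)
  exact ⟨hA₁.trans hA₃, hA₃, hB₁.trans hB₃, hB₃⟩
end
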